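/- arXiv:2204.08276 — 6 statements merged into one kernel-verified Lean document; each statement's English description precedes it below -/
import Mathlib

section
/- Consider a partial tournament whose set P of played matches contains each team in at most 3 matches and contains at most one of the two ordered matches of every unordered pair of teams. Then, under either the goal-difference tiebreak or the head-to-head tiebreak, for every team i there exist two completions of the partial tournament in which the final position of i differs. (In particular, the final position of a team that has played at most three matches is never determined.) -/
/-- Teams are the elements of `Fin 4`. -/
abbrev Team : Type := Fin 4

/-- A complete tournament assigns to each ordered pair `(i, j)` (with `i` at home)
a result `(goals scored by i, goals scored by j)`.  Only values at pairs of
distinct teams are meaningful. -/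
abbrev Tournament : Type := Team → Team → ℕ × ℕ

/-- Points obtained in a single match by a team scoring `g` goals and conceding `c`. -/
def matchPts (g c : ℕ) : ℕ := if c < g then 3 else if g = c then 1 else 0

/-- The set of all 12 ordered matches. -/
def allMatches : Finset (Team × Team) := Finset.univ.filter (fun m => m.1 ≠ m.2)

/-- Points of team `i` summed over the matches in `P` (the played matches). -/
def currentPts (P : Finset (Team × Team)) (T : Tournament) (i : Team) : ℕ :=
  ∑ m ∈ P,
    (if m.1 = i then matchPts (T m.1 m.2).1 (T m.1 m.2).2
     else if m.2 = i then matchPts (T m.1 m.2).2 (T m.1 m.2).1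
     else 0)

/-- Total points of team `i` in a complete tournament. -/
def totalPts (T : Tournament) (i : Team) : ℕ := currentPts allMatches T i

/-- Goal difference of team `i` in a complete tournament. -/
def goalDiff (T : Tournament) (i : Team) : ℤ :=
  ∑ m ∈ allMatches,
    (if m.1 = i then ((T m.1 m.2).1 : ℤ) - ((T m.1 m.2).2 : ℤ)
     else if m.2 = i then ((T m.1 m.2).2 : ℤ) - ((T m.1 m.2).1 : ℤ)
     else 0)

/-- Points obtained by team `i` in its two mutual matches against team `j`. -/
def mutualPts (T : Tournament) (i j : Team) : ℕ :=
  matchPts (T i j).1 (T i j).2 + matchPts (T j i).2 (T j i).1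

/-- Goal difference of team `i` in its two mutual matches against team `j`. -/
def mutualGD (T : Tournament) (i j : Team) : ℤ :=
  (((T i j).1 : ℤ) - ((T i j).2 : ℤ)) + (((T j i).2 : ℤ) - ((T j i).1 : ℤ))

/-- Goal-difference tiebreak: `i` is ranked strictly above `j`. -/
def RankedAboveGD (T : Tournament) (i j : Team) : Prop :=
  totalPts T j < totalPts T i ∨
    (totalPts T i = totalPts T j ∧ goalDiff T j < goalDiff T i)

/-- Head-to-head tiebreak: `i` is ranked strictly above `j`. -/
def RankedAboveH2H (T : Tournament) (i j : Team) : Prop :=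
  totalPts T j < totalPts T i ∨
    (totalPts T i = totalPts T j ∧ mutualPts T j i < mutualPts T i j) ∨
    (totalPts T i = totalPts T j ∧ mutualPts T i j = mutualPts T j i ∧
      mutualGD T j i < mutualGD T i j)

open Classical in
/-- Final position of team `i` under the goal-difference tiebreak. -/
noncomputable def finalPosGD (T : Tournament) (i : Team) : ℕ :=
  1 + (Finset.univ.filter (fun j => RankedAboveGD T j i)).card

open Classical in
/-- Final position of team `i` under the head-to-head tiebreak. -/
noncomputable def finalPosH2H (T : Tournament) (i : Team) : ℕ :=
  1 + (Finset.univ.filter (fun j => RankedAboveH2H T j i)).card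

/-- `T'` is a completion of the partial tournament `(P, T)`. -/
def Completes (P : Finset (Team × Team)) (T T' : Tournament) : Prop :=
  ∀ m ∈ P, T' m.1 m.2 = T m.1 m.2

/-- The set `P` of played matches corresponds to the situation after Matchday 4:
every unordered pair of distinct teams has at least one of its ordered matches
played, and exactly two unordered pairs — which are disjoint, forming a perfect
matching of the four teams — have both of their ordered matches played. -/
def AfterMD4 (P : Finset (Team × Team)) : Prop :=
  (∀ m ∈ P, m.1 ≠ m.2) ∧
  (∀ i j : Team, i ≠ j → (i, j) ∈ P ∨ (j, i) ∈ P) ∧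
  ∃ a b c d : Team,
    ({a, b, c, d} : Finset Team) = Finset.univ ∧
    (a, b) ∈ P ∧ (b, a) ∈ P ∧ (c, d) ∈ P ∧ (d, c) ∈ P ∧
    ∀ i j : Team, (i, j) ∈ P → (j, i) ∈ P →
      ({i, j} : Finset Team) = {a, b} ∨ ({i, j} : Finset Team) = {c, d}

theorem totalPts_eq_sum_mutualPts (T : Tournament) (a : Team) :
    totalPts T a = ∑ b ∈ Finset.univ.erase a, mutualPts T a b := by
  rw [← Finset.filter_ne', Finset.sum_filter, totalPts, currentPts, allMatches,
    Finset.sum_filter, Fintype.sum_prod_type]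
  fin_cases a <;> simp [Fin.sum_univ_four, mutualPts] <;> ring

theorem goalDiff_eq_sum_mutualGD (T : Tournament) (a : Team) :
    goalDiff T a = ∑ b ∈ Finset.univ.erase a, mutualGD T a b := by
  rw [← Finset.filter_ne', Finset.sum_filter, goalDiff, allMatches,
    Finset.sum_filter, Fintype.sum_prod_type]
  fin_cases a <;> simp [Fin.sum_univ_four, mutualGD] <;> ring

theorem matchPts_le_three (g c : ℕ) : matchPts g c ≤ 3 := by
  unfold matchPts; split_ifs <;> omega

theorem matchPts_of_lt {g c : ℕ} (h : c < g) : matchPts g c = 3 := if_pos h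

theorem matchPts_of_gt {g c : ℕ} (h : g < c) : matchPts g c = 0 := by
  unfold matchPts; split_ifs <;> omega

/-- If every pair of teams has an unplayed match, the goals `r a b` scored by `a` against `b`
in one such match can be prescribed freely; `x` and `d` collect the points and goal differences
of the other match of each pair. -/
theorem exists_completes_of_prescribed_goals (P : Finset (Team × Team)) (T : Tournament)
    (honce : ∀ i j : Team, (i, j) ∈ P → (j, i) ∉ P) :
    ∃ (x : Team → Team → ℕ) (d : Team → Team → ℤ), (∀ a b, x a b ≤ 3) ∧
      ∀ r : Team → Team → ℕ, ∃ T' : Tournament, Completes P T T' ∧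
        ∀ a b, a ≠ b → mutualPts T' a b = x a b + matchPts (r a b) (r b a) ∧
          mutualGD T' a b = d a b + r a b - r b a := by
  classical
  let free : Team → Team → Prop := fun a b => (a, b) ∉ P ∧ ((b, a) ∈ P ∨ a < b)
  have free_swap : ∀ a b, a ≠ b → (free b a ↔ ¬ free a b) := by
    intro a b hab
    have h₁ := honce a b
    have h₂ := honce b a
    have h₃ := lt_or_gt_of_ne hab
    have h₄ : a < b → ¬ b < a := fun h => h.asymm
    simp only [free]
    tauto
  refine ⟨fun a b => if free a b then matchPts (T b a).2 (T b a).1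
      else matchPts (T a b).1 (T a b).2,
    fun a b => if free a b then ((T b a).2 : ℤ) - (T b a).1 else ((T a b).1 : ℤ) - (T a b).2,
    fun a b => by dsimp only; split_ifs <;> exact matchPts_le_three _ _, fun r =>
    ⟨fun a b => if free a b then (r a b, r b a) else T a b, ?_, ?_⟩⟩
  · exact fun m hm => if_neg fun h => h.1 hm
  · intro a b hab
    have hs := free_swap a b hab
    by_cases h : free a b
    · have h' : ¬ free b a := fun h' => hs.1 h' h
      simp only [mutualPts, mutualGD, if_pos h, if_neg h']
      constructor <;> ring
    · have h' : free b a := hs.2 h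
      simp only [mutualPts, mutualGD, if_neg h, if_pos h']
      exact ⟨trivial, by ring⟩

/-- `i` is ranked strictly above `k` under either tiebreak rule whenever their total points
agree. -/
def WinsTies (T : Tournament) (i k : Team) : Prop :=
  goalDiff T k < goalDiff T i ∧ mutualPts T k i ≤ mutualPts T i k ∧ mutualGD T k i < mutualGD T i k

theorem WinsTies.rankedAboveGD_iff {T : Tournament} {i k : Team} (h : WinsTies T i k) :
    RankedAboveGD T i k ↔ totalPts T k ≤ totalPts T i := by
  unfold RankedAboveGD; have := h.1; omega

theorem WinsTies.rankedAboveH2H_iff {T : Tournament} {i k : Team} (h : WinsTies T i k) :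
    RankedAboveH2H T i k ↔ totalPts T k ≤ totalPts T i := by
  unfold RankedAboveH2H; obtain ⟨-, h₁, h₂⟩ := h; omega

theorem WinsTies.rankedAboveGD_swap_iff {T : Tournament} {i k : Team} (h : WinsTies T i k) :
    RankedAboveGD T k i ↔ totalPts T i < totalPts T k := by
  unfold RankedAboveGD; have := h.1; omega

theorem WinsTies.rankedAboveH2H_swap_iff {T : Tournament} {i k : Team} (h : WinsTies T i k) :
    RankedAboveH2H T k i ↔ totalPts T i < totalPts T k := by
  unfold RankedAboveH2H; obtain ⟨-, h₁, h₂⟩ := h; omega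

/-- The goals in the prescribed matches: `i` scores `u` and concedes `v` in each of its matches,
the other matches are given by `s`. -/
def goalsAgainst (i : Team) (u v : ℕ) (s : Team → Team → ℕ) (a b : Team) : ℕ :=
  if a = i then u else if b = i then v else s a b

theorem card_univ_erase_team (a : Team) : (Finset.univ.erase a).card = 3 := by
  simp [Finset.card_erase_of_mem]

section Prescribed

variable {T : Tournament} {x : Team → Team → ℕ} {d : Team → Team → ℤ} {i : Team} {u v : ℕ}
  {s : Team → Team → ℕ}

theorem totalPts_eq_of_goalsAgainst
    (hpts : ∀ a b, a ≠ b → mutualPts T a b =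
      x a b + matchPts (goalsAgainst i u v s a b) (goalsAgainst i u v s b a)) :
    totalPts T i = ∑ b ∈ Finset.univ.erase i, x i b + 3 * matchPts u v := by
  have h : ∀ b ∈ Finset.univ.erase i, mutualPts T i b = x i b + matchPts u v := by
    intro b hb
    have hb' := Finset.ne_of_mem_erase hb
    rw [hpts i b hb'.symm]
    simp [goalsAgainst, hb']
  rw [totalPts_eq_sum_mutualPts, Finset.sum_congr rfl h, Finset.sum_add_distrib,
    Finset.sum_const, card_univ_erase_team, smul_eq_mul]

theorem totalPts_eq_of_goalsAgainst_of_ne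
    (hpts : ∀ a b, a ≠ b → mutualPts T a b =
      x a b + matchPts (goalsAgainst i u v s a b) (goalsAgainst i u v s b a))
    {k : Team} (hk : k ≠ i) :
    totalPts T k = ∑ b ∈ Finset.univ.erase k, x k b + matchPts v u +
      ∑ b ∈ (Finset.univ.erase k).erase i, matchPts (s k b) (s b k) := by
  have hi : i ∈ Finset.univ.erase k := by simp [hk.symm]
  have h : ∀ b ∈ (Finset.univ.erase k).erase i,
      mutualPts T k b = x k b + matchPts (s k b) (s b k) := by
    intro b hb
    simp only [Finset.mem_erase] at hb
    rw [hpts k b hb.2.1.symm]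
    simp [goalsAgainst, hb.1, hk]
  have hki : mutualPts T k i = x k i + matchPts v u := by
    rw [hpts k i hk]; simp [goalsAgainst, hk]
  rw [totalPts_eq_sum_mutualPts, ← Finset.add_sum_erase _ _ hi, Finset.sum_congr rfl h,
    ← Finset.add_sum_erase _ (x k) hi, Finset.sum_add_distrib, hki]
  ring

theorem goalDiff_eq_of_goalsAgainst
    (hgd : ∀ a b, a ≠ b → mutualGD T a b =
      d a b + goalsAgainst i u v s a b - goalsAgainst i u v s b a) :
    goalDiff T i = ∑ b ∈ Finset.univ.erase i, d i b + 3 * ((u : ℤ) - v) := by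
  have h : ∀ b ∈ Finset.univ.erase i, mutualGD T i b = d i b + ((u : ℤ) - v) := by
    intro b hb
    have hb' := Finset.ne_of_mem_erase hb
    rw [hgd i b hb'.symm]
    simp [goalsAgainst, hb', add_sub_assoc]
  rw [goalDiff_eq_sum_mutualGD, Finset.sum_congr rfl h, Finset.sum_add_distrib,
    Finset.sum_const, card_univ_erase_team, nsmul_eq_mul, Nat.cast_ofNat]

theorem goalDiff_eq_of_goalsAgainst_of_ne
    (hgd : ∀ a b, a ≠ b → mutualGD T a b =
      d a b + goalsAgainst i u v s a b - goalsAgainst i u v s b a)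
    {k : Team} (hk : k ≠ i) :
    goalDiff T k = ∑ b ∈ Finset.univ.erase k, d k b + ((v : ℤ) - u) +
      ∑ b ∈ (Finset.univ.erase k).erase i, ((s k b : ℤ) - s b k) := by
  have hi : i ∈ Finset.univ.erase k := by simp [hk.symm]
  have h : ∀ b ∈ (Finset.univ.erase k).erase i,
      mutualGD T k b = d k b + ((s k b : ℤ) - s b k) := by
    intro b hb
    simp only [Finset.mem_erase] at hb
    rw [hgd k b hb.2.1.symm]
    simp [goalsAgainst, hb.1, hk, add_sub_assoc]
  have hki : mutualGD T k i = d k i + ((v : ℤ) - u) := by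
    rw [hgd k i hk]; simp [goalsAgainst, hk, add_sub_assoc]
  rw [goalDiff_eq_sum_mutualGD, ← Finset.add_sum_erase _ _ hi, Finset.sum_congr rfl h,
    ← Finset.add_sum_erase _ (d k) hi, Finset.sum_add_distrib, hki]
  ring

end Prescribed

theorem abs_sum_le_card_mul {S : Finset Team} {f : Team → ℤ} {N : ℤ} (h : ∀ b, |f b| ≤ N) :
    |∑ b ∈ S, f b| ≤ S.card * N :=
  (Finset.abs_sum_le_sum_abs _ _).trans <| by
    simpa using Finset.sum_le_card_nsmul S _ N fun b _ => h b

/-- If `i` wins (loses) its prescribed matches by a large margin, then it wins (loses) every tie. -/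
theorem exists_margin_winsTies (x : Team → Team → ℕ) (d : Team → Team → ℤ)
    (hx : ∀ a b, x a b ≤ 3) (i : Team) :
    ∃ M : ℕ, 0 < M ∧ ∀ s : Team → Team → ℕ, (∀ a b, s a b ≤ 1) →
      ∀ (T : Tournament) (u v : ℕ), (∀ a b, a ≠ b →
          mutualPts T a b =
            x a b + matchPts (goalsAgainst i u v s a b) (goalsAgainst i u v s b a) ∧
          mutualGD T a b = d a b + goalsAgainst i u v s a b - goalsAgainst i u v s b a) →
        ∀ k, k ≠ i → (u = M → v = 0 → WinsTies T i k) ∧ (u = 0 → v = M → WinsTies T k i) := by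
  obtain ⟨N, hN⟩ : ∃ N : ℕ, ∀ a b, |d a b| ≤ N := by
    refine ⟨∑ a, ∑ b, (d a b).natAbs, fun a b => ?_⟩
    rw [Int.abs_eq_natAbs, Nat.cast_le]
    exact (Finset.single_le_sum (f := fun b => (d a b).natAbs) (fun _ _ => Nat.zero_le _)
      (Finset.mem_univ b)).trans (Finset.single_le_sum (f := fun a => ∑ b, (d a b).natAbs)
      (fun _ _ => Nat.zero_le _) (Finset.mem_univ a))
  refine ⟨3 * N + 3, by omega, fun s hs T u v hT k hk => ?_⟩
  have hi := goalDiff_eq_of_goalsAgainst fun a b hab => (hT a b hab).2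
  have hk' := goalDiff_eq_of_goalsAgainst_of_ne (fun a b hab => (hT a b hab).2) hk
  have hDi := abs_sum_le_card_mul (S := Finset.univ.erase i) (hN i)
  have hDk := abs_sum_le_card_mul (S := Finset.univ.erase k) (hN k)
  have hS := abs_sum_le_card_mul (S := (Finset.univ.erase k).erase i)
    (f := fun b => (s k b : ℤ) - s b k) (N := 1) fun b => by
      have h₁ := hs k b
      have h₂ := hs b k
      rw [abs_le]; omega
  have hcard : ((Finset.univ.erase k).erase i).card ≤ 3 :=
    (Finset.card_erase_le).trans_eq (card_univ_erase_team k)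
  rw [card_univ_erase_team, abs_le] at hDi hDk
  rw [abs_le] at hS
  obtain ⟨hik, hik'⟩ := hT i k hk.symm
  obtain ⟨hki, hki'⟩ := hT k i hk
  have h₁ := abs_le.1 (hN i k)
  have h₂ := abs_le.1 (hN k i)
  have hx₁ := hx i k
  have hx₂ := hx k i
  simp only [goalsAgainst, if_true, if_neg hk] at hik hik' hki hki'
  constructor
  · rintro rfl rfl
    rw [matchPts_of_lt (by omega)] at hik
    rw [matchPts_of_gt (by omega)] at hki
    refine ⟨?_, ?_, ?_⟩ <;> push_cast at * <;> omega
  · rintro rfl rfl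
    rw [matchPts_of_gt (by omega)] at hik
    rw [matchPts_of_lt (by omega)] at hki
    refine ⟨?_, ?_, ?_⟩ <;> push_cast at * <;> omega

/-- Every team `i` has a best and a worst completion: every team ranked above `i` in the best one
is above it in the worst one, and some team `j` is above `i` in the worst one only. -/
theorem exists_best_worst_completions (P : Finset (Team × Team)) (T : Tournament)
    (honce : ∀ i j : Team, (i, j) ∈ P → (j, i) ∉ P) (i : Team) :
    ∃ T₁ T₂ : Tournament, Completes P T T₁ ∧ Completes P T T₂ ∧
      (∀ k, k ≠ i → WinsTies T₁ i k ∧ WinsTies T₂ k i ∧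
        (totalPts T₁ i < totalPts T₁ k → totalPts T₂ i ≤ totalPts T₂ k)) ∧
      ∃ j, j ≠ i ∧ totalPts T₁ j ≤ totalPts T₁ i ∧ totalPts T₂ i ≤ totalPts T₂ j := by
  obtain ⟨x, d, hx, hcompl⟩ := exists_completes_of_prescribed_goals P T honce
  obtain ⟨M, hM, hties⟩ := exists_margin_winsTies x d hx i
  obtain ⟨j, hj⟩ := exists_ne i
  have hsum : ∀ a, ∑ b ∈ Finset.univ.erase a, x a b ≤ 9 := fun a =>
    (Finset.sum_le_card_nsmul _ _ 3 fun b _ => hx a b).trans_eq (by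
      rw [card_univ_erase_team, smul_eq_mul])
  -- `j` loses its other prescribed matches if it has enough points already, and else wins them.
  obtain ⟨s, hs, hsj₁, hsj₂⟩ : ∃ s : Team → Team → ℕ, (∀ a b, s a b ≤ 1) ∧
      ∑ b ∈ Finset.univ.erase j, x j b +
          ∑ b ∈ (Finset.univ.erase j).erase i, matchPts (s j b) (s b j) ≤
        ∑ b ∈ Finset.univ.erase i, x i b + 9 ∧
      ∑ b ∈ Finset.univ.erase i, x i b ≤ ∑ b ∈ Finset.univ.erase j, x j b + 3 +
          ∑ b ∈ (Finset.univ.erase j).erase i, matchPts (s j b) (s b j) := by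
    have hi := hsum i
    have hj' := hsum j
    by_cases h : ∑ b ∈ Finset.univ.erase i, x i b ≤ ∑ b ∈ Finset.univ.erase j, x j b + 3
    · refine ⟨fun _ b => if b = j then 1 else 0, fun a b => by dsimp only; split_ifs <;> omega, ?_⟩
      have hlose : ∑ b ∈ (Finset.univ.erase j).erase i,
          matchPts (if b = j then 1 else 0) (if j = j then 1 else 0) = 0 :=
        Finset.sum_eq_zero fun b hb => by
          simp only [Finset.mem_erase] at hb
          simp [hb.2.1, matchPts_of_gt]
      dsimp only
      omega
    · refine ⟨fun a _ => if a = j then 1 else 0, fun a b => by dsimp only; split_ifs <;> omega, ?_⟩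
      have hwin : ∑ b ∈ (Finset.univ.erase j).erase i,
          matchPts (if j = j then 1 else 0) (if b = j then 1 else 0) = 2 * 3 := by
        have hcard : ((Finset.univ.erase j).erase i).card = 2 := by
          rw [Finset.card_erase_of_mem (by simp [hj.symm]), card_univ_erase_team]
        rw [← hcard]
        refine Finset.sum_const_nat fun b hb => ?_
        simp only [Finset.mem_erase] at hb
        simp [hb.2.1, matchPts_of_lt]
      dsimp only
      omega
  obtain ⟨T₁, hT₁, h₁⟩ := hcompl (goalsAgainst i M 0 s)
  obtain ⟨T₂, hT₂, h₂⟩ := hcompl (goalsAgainst i 0 M s)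
  have hi₁ := totalPts_eq_of_goalsAgainst fun a b hab => (h₁ a b hab).1
  have hi₂ := totalPts_eq_of_goalsAgainst fun a b hab => (h₂ a b hab).1
  have hk₁ := fun k => totalPts_eq_of_goalsAgainst_of_ne (k := k) fun a b hab => (h₁ a b hab).1
  have hk₂ := fun k => totalPts_eq_of_goalsAgainst_of_ne (k := k) fun a b hab => (h₂ a b hab).1
  simp only [matchPts_of_lt hM, matchPts_of_gt hM] at hi₁ hi₂ hk₁ hk₂
  refine ⟨T₁, T₂, hT₁, hT₂, fun k hk => ⟨(hties s hs T₁ M 0 h₁ k hk).1 rfl rfl,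
    (hties s hs T₂ 0 M h₂ k hk).2 rfl rfl, ?_⟩, j, hj, ?_, ?_⟩
  · rw [hi₁, hi₂, hk₁ k hk, hk₂ k hk]; omega
  · rw [hi₁, hk₁ j hj]; omega
  · rw [hi₂, hk₂ j hj]; omega

theorem not_rankedAboveGD_self (T : Tournament) (i : Team) : ¬ RankedAboveGD T i i := by
  unfold RankedAboveGD; omega

theorem not_rankedAboveH2H_self (T : Tournament) (i : Team) : ¬ RankedAboveH2H T i i := by
  unfold RankedAboveH2H; omega

open Classical in
theorem card_filter_lt_card_filter {p q : Team → Prop} (h : ∀ k, p k → q k)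
    (hj : ∃ j, ¬ p j ∧ q j) :
    (Finset.univ.filter p).card < (Finset.univ.filter q).card := by
  obtain ⟨j, hp, hq⟩ := hj
  refine Finset.card_lt_card (Finset.ssubset_iff_of_subset
    (Finset.monotone_filter_right _ fun k _ => h k) |>.2 ⟨j, ?_, ?_⟩) <;> simpa

/-- If each team appears in at most 3 played matches and at most one
of the two ordered matches of every unordered pair is played, then under either
tiebreak rule, for every team there exist two completions in which its final
position differs. -/
theorem finalPosition_not_determined_after_three_matches
    (P : Finset (Team × Team)) (T : Tournament)
    (hdist : ∀ m ∈ P, m.1 ≠ m.2)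
    (honce : ∀ i j : Team, (i, j) ∈ P → (j, i) ∉ P)
    (hthree : ∀ i : Team, (P.filter (fun m => m.1 = i ∨ m.2 = i)).card ≤ 3)
    (i : Team) :
    (∃ T₁ T₂ : Tournament, Completes P T T₁ ∧ Completes P T T₂ ∧
      finalPosGD T₁ i ≠ finalPosGD T₂ i) ∧
    (∃ T₁ T₂ : Tournament, Completes P T T₁ ∧ Completes P T T₂ ∧
      finalPosH2H T₁ i ≠ finalPosH2H T₂ i) := by
  obtain ⟨T₁, T₂, hT₁, hT₂, h, j, hj, hj₁, hj₂⟩ := exists_best_worst_completions P T honce i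
  refine ⟨⟨T₁, T₂, hT₁, hT₂, (Nat.add_lt_add_left (card_filter_lt_card_filter ?_ ?_) 1).ne⟩,
    ⟨T₁, T₂, hT₁, hT₂, (Nat.add_lt_add_left (card_filter_lt_card_filter ?_ ?_) 1).ne⟩⟩
  · intro k hk
    have hki : k ≠ i := by rintro rfl; exact not_rankedAboveGD_self _ _ hk
    obtain ⟨h₁, h₂, h₃⟩ := h k hki
    exact h₂.rankedAboveGD_iff.2 (h₃ (h₁.rankedAboveGD_swap_iff.1 hk))
  · obtain ⟨h₁, h₂, -⟩ := h j hj
    exact ⟨j, h₁.rankedAboveGD_swap_iff.not.2 hj₁.not_gt, h₂.rankedAboveGD_iff.2 hj₂⟩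
  · intro k hk
    have hki : k ≠ i := by rintro rfl; exact not_rankedAboveH2H_self _ _ hk
    obtain ⟨h₁, h₂, h₃⟩ := h k hki
    exact h₂.rankedAboveH2H_iff.2 (h₃ (h₁.rankedAboveH2H_swap_iff.1 hk))
  · obtain ⟨h₁, h₂, -⟩ := h j hj
    exact ⟨j, h₁.rankedAboveH2H_swap_iff.not.2 hj₁.not_gt, h₂.rankedAboveH2H_iff.2 hj₂⟩
end

section
/- After Matchday 4, under the goal-difference tiebreak, a team A is guaranteed to win the tournament if and only if the current points of A exceed the current points of every other team by at least 7. -/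
theorem subset_allMatches {P : Finset (Team × Team)} (hP : AfterMD4 P) : P ⊆ allMatches := by
  intro m hm
  simpa [allMatches] using hP.1 m hm

theorem disjoint_of_cover : ∀ a b c d : Team,
    ({a, b, c, d} : Finset Team) = Finset.univ → a ≠ c ∧ a ≠ d ∧ b ≠ c ∧ b ≠ d := by
  decide

/-- After Matchday 4 every team has met exactly one opponent twice. -/
theorem exists_double_opponent {P : Finset (Team × Team)} (hP : AfterMD4 P) (i : Team) :
    ∃ p, p ≠ i ∧ (i, p) ∈ P ∧ (p, i) ∈ P ∧ ∀ k, (i, k) ∈ P → (k, i) ∈ P → k = p := by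
  obtain ⟨hne, -, a, b, c, d, hu, hab, hba, hcd, hdc, hd⟩ := hP
  obtain ⟨hac, had, hbc, hbd⟩ := disjoint_of_cover a b c d hu
  have hab' : a ≠ b := hne _ hab
  have hcd' : c ≠ d := hne _ hcd
  have hi : i ∈ ({a, b, c, d} : Finset Team) := hu ▸ Finset.mem_univ i
  have key : ∀ k, (i, k) ∈ P → (k, i) ∈ P →
      k ≠ i ∧ ((i = a ∨ i = b) ∧ (k = a ∨ k = b) ∨ (i = c ∨ i = d) ∧ (k = c ∨ k = d)) := by
    intro k h h'
    have mem : ∀ s : Finset Team, {i, k} = s → i ∈ s ∧ k ∈ s := by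
      rintro _ rfl
      simp
    simpa using And.intro (hne _ h') ((hd i k h h').imp (mem _) (mem _))
  simp only [Finset.mem_insert, Finset.mem_singleton] at hi
  rcases hi with rfl | rfl | rfl | rfl
  · exact ⟨b, hab'.symm, hab, hba, fun k h h' => by have := key k h h'; grind only⟩
  · exact ⟨a, hab', hba, hab, fun k h h' => by have := key k h h'; grind only⟩
  · exact ⟨d, hcd'.symm, hcd, hdc, fun k h h' => by have := key k h h'; grind only⟩
  · exact ⟨c, hcd', hdc, hcd, fun k h h' => by have := key k h h'; grind only⟩

/-- After Matchday 4 every team has two matches left. -/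
theorem card_remaining {P : Finset (Team × Team)} (hP : AfterMD4 P) (i : Team) :
    ((allMatches \ P).filter (fun m => m.1 = i ∨ m.2 = i)).card = 2 := by
  obtain ⟨p, hpi, hip, hpi', hp⟩ := exists_double_opponent hP i
  have hcard : (({i, p} : Finset Team)ᶜ).card = 2 := by
    rw [Finset.card_compl, Finset.card_pair hpi.symm, Fintype.card_fin]
  have hor := hP.2.1
  rw [← hcard]
  refine Finset.card_nbij' (fun m => if m.1 = i then m.2 else m.1)
    (fun k => if (i, k) ∈ P then (k, i) else (i, k)) ?_ ?_ ?_ ?_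
  · rintro ⟨x, y⟩ h
    simp [allMatches] at h ⊢
    grind
  · intro k h
    simp [allMatches] at h ⊢
    grind
  · rintro ⟨x, y⟩ h
    simp [allMatches] at h ⊢
    grind
  · intro k h
    simp at h ⊢
    grind

theorem sum_remaining {M : Type*} [AddCommMonoid M] {P : Finset (Team × Team)}
    (hP : AfterMD4 P) (i : Team) (f : Team × Team → M) (c : M)
    (hf : ∀ m ∈ allMatches \ P, f m = if m.1 = i ∨ m.2 = i then c else 0) :
    ∑ m ∈ allMatches \ P, f m = 2 • c := by
  rw [Finset.sum_congr rfl hf, ← Finset.sum_filter, Finset.sum_const, card_remaining hP]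

theorem totalPts_eq_add {P : Finset (Team × Team)} (hP : AfterMD4 P) (T : Tournament)
    (i : Team) : totalPts T i = currentPts (allMatches \ P) T i + currentPts P T i := by
  unfold totalPts currentPts
  exact (Finset.sum_sdiff (subset_allMatches hP)).symm

theorem currentPts_congr {P : Finset (Team × Team)} {T T' : Tournament}
    (h : Completes P T T') (i : Team) : currentPts P T' i = currentPts P T i :=
  Finset.sum_congr rfl fun m hm => by rw [h m hm]

theorem currentPts_remaining_le {P : Finset (Team × Team)} (hP : AfterMD4 P) (T : Tournament)
    (i : Team) : currentPts (allMatches \ P) T i ≤ 6 := by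
  refine le_trans (Finset.sum_le_sum fun m _ => ?_)
    (sum_remaining hP i (fun m => if m.1 = i ∨ m.2 = i then 3 else 0) 3 fun _ _ => rfl).le
  have h₁ := matchPts_le_three (T m.1 m.2).1 (T m.1 m.2).2
  have h₂ := matchPts_le_three (T m.1 m.2).2 (T m.1 m.2).1
  grind

/-- Goal difference of team `i` over the matches in `P`. -/
def currentGD (P : Finset (Team × Team)) (T : Tournament) (i : Team) : ℤ :=
  ∑ m ∈ P,
    (if m.1 = i then ((T m.1 m.2).1 : ℤ) - ((T m.1 m.2).2 : ℤ)
     else if m.2 = i then ((T m.1 m.2).2 : ℤ) - ((T m.1 m.2).1 : ℤ)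
     else 0)

theorem goalDiff_eq_add {P : Finset (Team × Team)} (hP : AfterMD4 P) (T : Tournament)
    (i : Team) : goalDiff T i = currentGD (allMatches \ P) T i + currentGD P T i :=
  (Finset.sum_sdiff (subset_allMatches hP)).symm

theorem currentGD_congr {P : Finset (Team × Team)} {T T' : Tournament}
    (h : Completes P T T') (i : Team) : currentGD P T' i = currentGD P T i :=
  Finset.sum_congr rfl fun m hm => by rw [h m hm]

/-- The completion in which, in the remaining matches, `j` wins and `A` loses every time
by `N` goals. -/
def adverseCompletion (P : Finset (Team × Team)) (T : Tournament) (A j : Team) (N : ℕ) :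
    Tournament := fun x y =>
  if (x, y) ∈ P then T x y
  else if x = j ∨ y = A then (N, 0)
  else (0, N)

theorem completes_adverseCompletion (P : Finset (Team × Team)) (T : Tournament) (A j : Team)
    (N : ℕ) : Completes P T (adverseCompletion P T A j N) := fun _ hm => if_pos hm

theorem currentPts_adverseCompletion_winner {P : Finset (Team × Team)} (hP : AfterMD4 P) (T : Tournament)
    {A j : Team} (hj : j ≠ A) {N : ℕ} (hN : 0 < N) :
    currentPts (allMatches \ P) (adverseCompletion P T A j N) j = 6 := by
  refine (sum_remaining hP j _ 3 ?_).trans (by simp)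
  rintro ⟨x, y⟩ h
  simp only [allMatches, Finset.mem_sdiff, Finset.mem_filter, Finset.mem_univ, true_and] at h
  simp only [adverseCompletion, matchPts, if_neg h.2]
  grind

theorem currentPts_adverseCompletion_loser {P : Finset (Team × Team)} (hP : AfterMD4 P) (T : Tournament)
    {A j : Team} (hj : j ≠ A) {N : ℕ} (hN : 0 < N) :
    currentPts (allMatches \ P) (adverseCompletion P T A j N) A = 0 := by
  refine (sum_remaining hP A _ 0 ?_).trans (by simp)
  rintro ⟨x, y⟩ h
  simp only [allMatches, Finset.mem_sdiff, Finset.mem_filter, Finset.mem_univ, true_and] at h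
  simp only [adverseCompletion, matchPts, if_neg h.2]
  grind

theorem currentGD_adverseCompletion_winner {P : Finset (Team × Team)} (hP : AfterMD4 P) (T : Tournament)
    {A j : Team} (hj : j ≠ A) (N : ℕ) :
    currentGD (allMatches \ P) (adverseCompletion P T A j N) j = 2 * (N : ℤ) := by
  refine (sum_remaining hP j _ (N : ℤ) ?_).trans (by simp)
  rintro ⟨x, y⟩ h
  simp only [allMatches, Finset.mem_sdiff, Finset.mem_filter, Finset.mem_univ, true_and] at h
  simp only [adverseCompletion, if_neg h.2]
  grind

theorem currentGD_adverseCompletion_loser {P : Finset (Team × Team)} (hP : AfterMD4 P) (T : Tournament)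
    {A j : Team} (hj : j ≠ A) (N : ℕ) :
    currentGD (allMatches \ P) (adverseCompletion P T A j N) A = -(2 * (N : ℤ)) := by
  refine (sum_remaining hP A _ (-N : ℤ) ?_).trans (by simp)
  rintro ⟨x, y⟩ h
  simp only [allMatches, Finset.mem_sdiff, Finset.mem_filter, Finset.mem_univ, true_and] at h
  simp only [adverseCompletion, if_neg h.2]
  grind

/-- After Matchday 4, under the goal-difference tiebreak, team `A`
is guaranteed to win iff its current points exceed the current points of every
other team by at least 7. -/
theorem guaranteedWin_GD_iff
    (P : Finset (Team × Team)) (T : Tournament) (hP : AfterMD4 P) (A : Team) :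
    (∀ T' : Tournament, Completes P T T' → ∀ j : Team, j ≠ A → RankedAboveGD T' A j) ↔
    (∀ j : Team, j ≠ A → currentPts P T j + 7 ≤ currentPts P T A) := by
  constructor
  · intro h j hj
    by_contra! hlt
    set N : ℕ := (currentGD P T A).natAbs + (currentGD P T j).natAbs + 1 with hN
    have hN0 : 0 < N := by omega
    have hc := completes_adverseCompletion P T A j N
    have hr := h _ hc j hj
    rw [RankedAboveGD, totalPts_eq_add hP, totalPts_eq_add hP, goalDiff_eq_add hP,
      goalDiff_eq_add hP, currentPts_congr hc, currentPts_congr hc, currentGD_congr hc,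
      currentGD_congr hc, currentPts_adverseCompletion_winner hP T hj hN0,
      currentPts_adverseCompletion_loser hP T hj hN0,
      currentGD_adverseCompletion_winner hP T hj,
      currentGD_adverseCompletion_loser hP T hj] at hr
    omega
  · intro h T' hc j hj
    left
    have hle := currentPts_remaining_le hP T' j
    have hlead := h j hj
    rw [totalPts_eq_add hP, totalPts_eq_add hP, currentPts_congr hc, currentPts_congr hc]
    omega
end

section
/- After Matchday 4, under the head-to-head tiebreak, a team A is guaranteed to win the tournament if and only if either (i) the current points of A exceed the current points of every other team by at least 7, or (ii) there is a team B such that A's current points exceed B's current points by exactly 6, A's current points exceed the current points of every team other than A and B by at least 7, and both ordered matches between A and B belong to P (A has already played two matches against B). -/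
/-- Points obtained by team `i` against team `j` in the matches of `P` between them. -/
def pairPts (P : Finset (Team × Team)) (T : Tournament) (i j : Team) : ℕ :=
  (if (i, j) ∈ P then matchPts (T i j).1 (T i j).2 else 0) +
    (if (j, i) ∈ P then matchPts (T j i).2 (T j i).1 else 0)

/-- The pairs `{A, B}` and `{C, D}` have played both of their matches, and every other pair
exactly one. -/
structure DoublePairs (P : Finset (Team × Team)) (A B C D : Team) : Prop where
  univ_eq : ({A, B, C, D} : Finset Team) = Finset.univ
  memAB : (A, B) ∈ P
  memBA : (B, A) ∈ P
  memCD : (C, D) ∈ P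
  memDC : (D, C) ∈ P
  crossAC : (A, C) ∈ P ↔ (C, A) ∉ P
  crossAD : (A, D) ∈ P ↔ (D, A) ∉ P
  crossBC : (B, C) ∈ P ↔ (C, B) ∉ P
  crossBD : (B, D) ∈ P ↔ (D, B) ∉ P

theorem pairwise_ne_of_univ_eq : ∀ {A B C D : Team},
    ({A, B, C, D} : Finset Team) = Finset.univ →
      A ≠ B ∧ A ≠ C ∧ A ≠ D ∧ B ≠ C ∧ B ≠ D ∧ C ≠ D := by
  decide

theorem sum_of_univ_eq {A B C D : Team} (h : ({A, B, C, D} : Finset Team) = Finset.univ)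
    (f : Team → ℕ) : ∑ j, f j = f A + f B + f C + f D := by
  obtain ⟨h1, h2, h3, h4, h5, h6⟩ := pairwise_ne_of_univ_eq h
  rw [← h, Finset.sum_insert (by simp [*]), Finset.sum_insert (by simp [*]),
    Finset.sum_insert (by simp [*]), Finset.sum_singleton]
  ring

namespace DoublePairs

variable {P : Finset (Team × Team)} {A B C D : Team}

theorem swap_left (h : DoublePairs P A B C D) : DoublePairs P B A C D where
  univ_eq := by rw [← h.univ_eq, Finset.insert_comm]
  memAB := h.memBA
  memBA := h.memAB
  memCD := h.memCD
  memDC := h.memDC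
  crossAC := h.crossBC
  crossAD := h.crossBD
  crossBC := h.crossAC
  crossBD := h.crossAD

theorem swap_pairs (h : DoublePairs P A B C D) : DoublePairs P C D A B where
  univ_eq := by
    rw [← h.univ_eq]
    ext x
    simp only [Finset.mem_insert, Finset.mem_singleton]
    tauto
  memAB := h.memCD
  memBA := h.memDC
  memCD := h.memAB
  memDC := h.memBA
  crossAC := by have := h.crossAC; tauto
  crossAD := by have := h.crossBC; tauto
  crossBC := by have := h.crossAD; tauto
  crossBD := by have := h.crossBD; tauto

theorem eq_of_mem_of_mem (h : DoublePairs P A B C D) {j : Team} (hj : j ≠ A)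
    (h₁ : (A, j) ∈ P) (h₂ : (j, A) ∈ P) : j = B := by
  have hmem : j ∈ ({A, B, C, D} : Finset Team) := h.univ_eq ▸ Finset.mem_univ j
  simp only [Finset.mem_insert, Finset.mem_singleton] at hmem
  rcases hmem with rfl | rfl | rfl | rfl
  · exact absurd rfl hj
  · rfl
  · exact absurd h₂ (h.crossAC.1 h₁)
  · exact absurd h₂ (h.crossAD.1 h₁)

end DoublePairs

theorem AfterMD4.exists_doublePairs {P : Finset (Team × Team)} (hP : AfterMD4 P) (A : Team) :
    ∃ B C D, DoublePairs P A B C D := by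
  obtain ⟨-, hsome, a, b, c, d, hu, hab, hba, hcd, hdc, honly⟩ := hP
  have hcross : ∀ a b c d : Team, ({a, b, c, d} : Finset Team) = Finset.univ →
      ∀ i j : Team, (i = a ∨ i = b) → (j = c ∨ j = d) →
        i ≠ j ∧ ({i, j} : Finset Team) ≠ {a, b} ∧ ({i, j} : Finset Team) ≠ {c, d} := by
    decide
  have key : ∀ i j : Team, (i = a ∨ i = b) → (j = c ∨ j = d) →
      ((i, j) ∈ P ↔ (j, i) ∉ P) := by
    intro i j hi hj
    obtain ⟨h₁, h₂, h₃⟩ := hcross a b c d hu i j hi hj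
    have := hsome i j h₁
    have := honly i j
    tauto
  have h : DoublePairs P a b c d :=
    ⟨hu, hab, hba, hcd, hdc, key a c (.inl rfl) (.inl rfl), key a d (.inl rfl) (.inr rfl),
      key b c (.inr rfl) (.inl rfl), key b d (.inr rfl) (.inr rfl)⟩
  have hmem : A ∈ ({a, b, c, d} : Finset Team) := hu ▸ Finset.mem_univ A
  simp only [Finset.mem_insert, Finset.mem_singleton] at hmem
  rcases hmem with rfl | rfl | rfl | rfl
  · exact ⟨_, _, _, h⟩
  · exact ⟨_, _, _, h.swap_left⟩
  · exact ⟨_, _, _, h.swap_pairs⟩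
  · exact ⟨_, _, _, h.swap_pairs.swap_left⟩

theorem matchPts_cases (g c : ℕ) :
    (matchPts g c = 3 ∧ matchPts c g = 0) ∨ (matchPts g c = 1 ∧ matchPts c g = 1) ∨
      (matchPts g c = 0 ∧ matchPts c g = 3) := by
  unfold matchPts
  split_ifs <;> omega

theorem pairPts_of_mem_of_mem {P : Finset (Team × Team)} (T : Tournament) {i j : Team}
    (h₁ : (i, j) ∈ P) (h₂ : (j, i) ∈ P) : pairPts P T i j = mutualPts T i j := by
  simp [pairPts, mutualPts, h₁, h₂]

theorem mutualPts_add_le (T : Tournament) (i j : Team) :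
    mutualPts T i j + mutualPts T j i ≤ 6 := by
  have := matchPts_cases (T i j).1 (T i j).2
  have := matchPts_cases (T j i).1 (T j i).2
  unfold mutualPts
  omega

theorem pairPts_cases {P : Finset (Team × Team)} (T : Tournament) {i j : Team}
    (h : (i, j) ∈ P ↔ (j, i) ∉ P) :
    (pairPts P T i j = 3 ∧ pairPts P T j i = 0) ∨ (pairPts P T i j = 1 ∧ pairPts P T j i = 1) ∨
      (pairPts P T i j = 0 ∧ pairPts P T j i = 3) := by
  have h₁ := matchPts_cases (T i j).1 (T i j).2
  have h₂ := matchPts_cases (T j i).1 (T j i).2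
  unfold pairPts
  by_cases hij : (i, j) ∈ P
  · simpa [hij, h.1 hij] using h₁
  · have hji : (j, i) ∈ P := by tauto
    simp only [hij, hji, if_true, if_false]
    omega

theorem currentPts_eq_sum_pairPts {P : Finset (Team × Team)} (hP : ∀ m ∈ P, m.1 ≠ m.2)
    (T : Tournament) (i : Team) : currentPts P T i = ∑ j, pairPts P T i j := by
  have hsplit : currentPts P T i =
      ∑ m : Team × Team,
        ((if m.1 = i then if m ∈ P then matchPts (T m.1 m.2).1 (T m.1 m.2).2 else 0 else 0) +
          (if m.2 = i then if m ∈ P then matchPts (T m.1 m.2).2 (T m.1 m.2).1 else 0 else 0)) := by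
    rw [currentPts, ← Finset.sum_subset (Finset.subset_univ P)]
    · refine Finset.sum_congr rfl fun m hm => ?_
      have := hP m hm
      by_cases h₁ : m.1 = i
      · have h₂ : m.2 ≠ i := fun h => this (h₁.trans h.symm)
        simp [h₁, h₂, hm]
      · simp [h₁, hm]
    · intro m _ hm
      simp [hm]
  rw [hsplit, Finset.sum_add_distrib, Fintype.sum_prod_type, Fintype.sum_prod_type]
  simp only [pairPts, Finset.sum_add_distrib]
  congr 1
  · rw [Finset.sum_comm]
    simp
  · simp

theorem DoublePairs.currentPts_eq {P : Finset (Team × Team)} {A B C D : Team}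
    (h : DoublePairs P A B C D) (hP : ∀ m ∈ P, m.1 ≠ m.2) (T : Tournament) :
    currentPts P T A = pairPts P T A B + pairPts P T A C + pairPts P T A D := by
  have hA : (A, A) ∉ P := fun hm => hP _ hm rfl
  rw [currentPts_eq_sum_pairPts hP, sum_of_univ_eq h.univ_eq]
  simp [pairPts, hA]

theorem totalPts_eq_mutualPts {A B C D : Team}
    (h : ({A, B, C, D} : Finset Team) = Finset.univ) (T : Tournament) :
    totalPts T A = mutualPts T A B + mutualPts T A C + mutualPts T A D := by
  obtain ⟨h₁, h₂, h₃, -⟩ := pairwise_ne_of_univ_eq h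
  rw [totalPts, currentPts_eq_sum_pairPts (by simp [allMatches]), sum_of_univ_eq h]
  simp [pairPts, mutualPts, allMatches, h₁, h₂, h₃, h₁.symm, h₂.symm, h₃.symm]

theorem mutualPts_eq_of_mem {P : Finset (Team × Team)} {T T' : Tournament}
    (hT : Completes P T T') {i j : Team} (h₁ : (i, j) ∈ P) (h₂ : (j, i) ∈ P) :
    mutualPts T' i j = mutualPts T i j := by
  have e₁ : T' i j = T i j := hT _ h₁
  have e₂ : T' j i = T j i := hT _ h₂
  simp only [mutualPts, e₁, e₂]

/-- If team `i` obtains between `l` and `u` points in each match outside `P`, then the two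
matches left to it add between `2 * l` and `2 * u` points. -/
theorem totalPts_bounds {P : Finset (Team × Team)} (hP : AfterMD4 P) {T T' : Tournament}
    (hT : Completes P T T') (i : Team) (l u : ℕ)
    (hhome : ∀ j, j ≠ i → (i, j) ∉ P →
      l ≤ matchPts (T' i j).1 (T' i j).2 ∧ matchPts (T' i j).1 (T' i j).2 ≤ u)
    (haway : ∀ j, j ≠ i → (j, i) ∉ P →
      l ≤ matchPts (T' j i).2 (T' j i).1 ∧ matchPts (T' j i).2 (T' j i).1 ≤ u) :
    currentPts P T i + 2 * l ≤ totalPts T' i ∧ totalPts T' i ≤ currentPts P T i + 2 * u := by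
  obtain ⟨B, C, D, h⟩ := hP.exists_doublePairs i
  obtain ⟨-, hC, hD, -⟩ := pairwise_ne_of_univ_eq h.univ_eq
  have key : ∀ j, j ≠ i → ((i, j) ∈ P ↔ (j, i) ∉ P) →
      pairPts P T i j + l ≤ mutualPts T' i j ∧ mutualPts T' i j ≤ pairPts P T i j + u := by
    intro j hj hij
    unfold pairPts mutualPts
    by_cases hm : (i, j) ∈ P
    · have e : T' i j = T i j := hT _ hm
      have := haway j hj (hij.1 hm)
      simp only [hm, hij.1 hm, if_true, if_false, e]
      omega
    · have hm' : (j, i) ∈ P := by tauto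
      have e : T' j i = T j i := hT _ hm'
      have := hhome j hj hm
      simp only [hm, hm', if_true, if_false, e]
      omega
  have hkC := key C hC.symm h.crossAC
  have hkD := key D hD.symm h.crossAD
  have hkB := mutualPts_eq_of_mem hT h.memAB h.memBA
  rw [h.currentPts_eq hP.1, totalPts_eq_mutualPts h.univ_eq,
    pairPts_of_mem_of_mem T h.memAB h.memBA]
  omega

/-- The completion in which `X` wins each of its remaining matches, and `A` loses each of its
own, by `n` goals to nil. -/
def worstCase (P : Finset (Team × Team)) (T : Tournament) (A X : Team) (n : ℕ) : Tournament :=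
  fun i j =>
    if (i, j) ∈ P then T i j
    else if i = X ∨ j = A then (n, 0)
    else if j = X ∨ i = A then (0, n)
    else (0, 0)

theorem worstCase_completes (P : Finset (Team × Team)) (T : Tournament) (A X : Team) (n : ℕ) :
    Completes P T (worstCase P T A X n) := by
  rintro ⟨i, j⟩ hm
  simp [worstCase, hm]

theorem totalPts_worstCase_left {P : Finset (Team × Team)} (hP : AfterMD4 P) (T : Tournament)
    {A X : Team} (hX : X ≠ A) {n : ℕ} (hn : 0 < n) :
    totalPts (worstCase P T A X n) A = currentPts P T A := by
  have := totalPts_bounds hP (worstCase_completes P T A X n) A 0 0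
    (fun j hj hm => by simp [worstCase, hm, hX.symm, hj, matchPts, hn.ne])
    (fun j hj hm => by simp [worstCase, hm, matchPts, hn.ne])
  omega

theorem totalPts_worstCase_right {P : Finset (Team × Team)} (hP : AfterMD4 P) (T : Tournament)
    {A X : Team} (hX : X ≠ A) {n : ℕ} (hn : 0 < n) :
    totalPts (worstCase P T A X n) X = currentPts P T X + 6 := by
  have := totalPts_bounds hP (worstCase_completes P T A X n) X 3 3
    (fun j hj hm => by simp [worstCase, hm, matchPts, hn])
    (fun j hj hm => by simp [worstCase, hm, hX, hj, matchPts, hn])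
  omega

/-- If `A` and `X` still have a match to play, a large enough win of `X` in it gives `X` the
head-to-head tiebreak. -/
theorem not_rankedAboveH2H_worstCase {P : Finset (Team × Team)} (hP : AfterMD4 P)
    (T : Tournament) {A X : Team} (hX : X ≠ A)
    (hle : currentPts P T A ≤ currentPts P T X + 6) (hPX : ¬((A, X) ∈ P ∧ (X, A) ∈ P)) :
    ¬RankedAboveH2H (worstCase P T A X ((T A X).1 + (T X A).2 + 1)) A X := by
  set n := (T A X).1 + (T X A).2 + 1 with hn
  have hsome := hP.2.1 A X hX.symm
  have hA := totalPts_worstCase_left hP T hX (n := n) (by omega)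
  have hXp := totalPts_worstCase_right hP T hX (n := n) (by omega)
  have hpos : 0 < n := by omega
  rw [RankedAboveH2H, hA, hXp]
  have hfin : mutualPts (worstCase P T A X n) A X ≤ mutualPts (worstCase P T A X n) X A ∧
      mutualGD (worstCase P T A X n) A X ≤ mutualGD (worstCase P T A X n) X A := by
    by_cases hm : (A, X) ∈ P
    · have hm' : (X, A) ∉ P := fun h => hPX ⟨hm, h⟩
      have := matchPts_le_three (T A X).1 (T A X).2
      have hw : matchPts n 0 = 3 := by simp [matchPts, hpos]
      have hl : matchPts 0 n = 0 := by simp [matchPts, hpos.ne]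
      simp only [mutualPts, mutualGD, worstCase, hm, hm', if_true, if_false, true_or, hw, hl]
      omega
    · have hm' : (X, A) ∈ P := hsome.resolve_left hm
      have := matchPts_le_three (T X A).2 (T X A).1
      have hw : matchPts n 0 = 3 := by simp [matchPts, hpos]
      have hl : matchPts 0 n = 0 := by simp [matchPts, hpos.ne]
      simp only [mutualPts, mutualGD, worstCase, hm, hm', if_true, if_false, hX,
        hX.symm, or_self, hw, hl]
      omega
  omega

/-- A team that is six points ahead of an opponent it has already met twice, and seven ahead of
the others, has the better mutual record against that opponent. -/
theorem DoublePairs.mutualPts_lt {P : Finset (Team × Team)} {A B C D : Team}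
    (h : DoublePairs P A B C D) (hP : ∀ m ∈ P, m.1 ≠ m.2) (T : Tournament)
    (hB : currentPts P T A = currentPts P T B + 6)
    (hC : currentPts P T C + 7 ≤ currentPts P T A) :
    mutualPts T B A < mutualPts T A B := by
  rw [h.currentPts_eq hP, h.swap_left.currentPts_eq hP,
    pairPts_of_mem_of_mem T h.memAB h.memBA, pairPts_of_mem_of_mem T h.memBA h.memAB] at hB
  rw [h.currentPts_eq hP, h.swap_pairs.currentPts_eq hP,
    pairPts_of_mem_of_mem T h.memAB h.memBA] at hC
  have := mutualPts_add_le T A B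
  have := pairPts_cases T h.crossAC
  have := pairPts_cases T h.crossAD
  have := pairPts_cases T h.crossBC
  have := pairPts_cases T h.crossBD
  omega


/-- After Matchday 4, under the head-to-head tiebreak, team `A`
is guaranteed to win iff (i) it leads every other team by at least 7 points, or
(ii) it leads some team `B` by exactly 6 points, leads every other team by at
least 7 points, and has already played both matches against `B`. -/
theorem guaranteedWin_H2H_iff
    (P : Finset (Team × Team)) (T : Tournament) (hP : AfterMD4 P) (A : Team) :
    (∀ T' : Tournament, Completes P T T' → ∀ j : Team, j ≠ A → RankedAboveH2H T' A j) ↔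
    ((∀ j : Team, j ≠ A → currentPts P T j + 7 ≤ currentPts P T A) ∨
      (∃ B : Team, B ≠ A ∧
        currentPts P T A = currentPts P T B + 6 ∧
        (∀ j : Team, j ≠ A → j ≠ B → currentPts P T j + 7 ≤ currentPts P T A) ∧
        (A, B) ∈ P ∧ (B, A) ∈ P)) := by
  constructor
  · intro hwin
    have hlead : ∀ X, X ≠ A → currentPts P T X + 7 ≤ currentPts P T A ∨
        (currentPts P T A = currentPts P T X + 6 ∧ (A, X) ∈ P ∧ (X, A) ∈ P) := by
      intro X hX
      by_contra! hcon
      by_cases hPX : (A, X) ∈ P ∧ (X, A) ∈ P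
      · have hr := hwin _ (worstCase_completes P T A X 1) X hX
        rw [RankedAboveH2H, totalPts_worstCase_left hP T hX one_pos,
          totalPts_worstCase_right hP T hX one_pos] at hr
        have hne : currentPts P T A ≠ currentPts P T X + 6 := fun he => hcon.2 he hPX.1 hPX.2
        omega
      · exact not_rankedAboveH2H_worstCase hP T hX (by omega) hPX
          (hwin _ (worstCase_completes P T A X _) X hX)
    obtain ⟨B, C, D, h⟩ := hP.exists_doublePairs A
    by_cases hall : ∀ j, j ≠ A → currentPts P T j + 7 ≤ currentPts P T A
    · exact .inl hall
    · push Not at hall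
      obtain ⟨X, hX, hlt⟩ := hall
      obtain ⟨heq, h₁, h₂⟩ := (hlead X hX).resolve_left (by omega)
      refine .inr ⟨X, hX, heq, fun j hj hjX => (hlead j hj).resolve_right ?_, h₁, h₂⟩
      rintro ⟨-, h₃, h₄⟩
      exact hjX ((h.eq_of_mem_of_mem hj h₃ h₄).trans (h.eq_of_mem_of_mem hX h₁ h₂).symm)
  · intro hlead T' hT j hj
    have hbound : ∀ i, currentPts P T i ≤ totalPts T' i ∧
        totalPts T' i ≤ currentPts P T i + 6 := fun i =>
      totalPts_bounds hP hT i 0 3 (fun _ _ _ => ⟨Nat.zero_le _, matchPts_le_three _ _⟩)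
        (fun _ _ _ => ⟨Nat.zero_le _, matchPts_le_three _ _⟩)
    have hA := hbound A
    have hj' := hbound j
    rcases hlead with hall | ⟨B, hB, heq, hothers, h₁, h₂⟩
    · have := hall j hj
      exact .inl (by omega)
    · by_cases hjB : j = B
      · subst hjB
        obtain ⟨B, C, D, h⟩ := hP.exists_doublePairs A
        obtain rfl := h.eq_of_mem_of_mem hj h₁ h₂
        obtain ⟨-, hAC, -, hBC, -⟩ := pairwise_ne_of_univ_eq h.univ_eq
        have hlt := h.mutualPts_lt hP.1 T heq (hothers C hAC.symm hBC.symm)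
        rw [← mutualPts_eq_of_mem hT h₁ h₂, ← mutualPts_eq_of_mem hT h₂ h₁] at hlt
        rw [RankedAboveH2H]
        omega
      · have := hothers j hj hjB
        exact .inl (by omega)
end

section
/- After Matchday 4, under either the goal-difference tiebreak or the head-to-head tiebreak, there is no team whose final position equals 2 in every completion, and there is no team whose final position equals 3 in every completion. (The second- and third-placed clubs cannot be determined after Matchday 4.) -/
/-- In `P`, the pairs `{a, b}` and `{c, d}` have met twice and all other pairs exactly once. -/
structure IsPairing (P : Finset (Team × Team)) (a b c d : Team) : Prop where
  univ_eq : ({a, b, c, d} : Finset Team) = Finset.univ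
  ab : (a, b) ∈ P
  ba : (b, a) ∈ P
  cd : (c, d) ∈ P
  dc : (d, c) ∈ P
  ac : Xor ((a, c) ∈ P) ((c, a) ∈ P)
  ad : Xor ((a, d) ∈ P) ((d, a) ∈ P)
  bc : Xor ((b, c) ∈ P) ((c, b) ∈ P)
  bd : Xor ((b, d) ∈ P) ((d, b) ∈ P)

namespace IsPairing

variable {P : Finset (Team × Team)} {a b c d : Team}

theorem swap_left (h : IsPairing P a b c d) : IsPairing P b a c d :=
  ⟨by rw [← h.univ_eq, Finset.insert_comm], h.ba, h.ab, h.cd, h.dc, h.bc, h.bd, h.ac, h.ad⟩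

theorem swap_right (h : IsPairing P a b c d) : IsPairing P a b d c :=
  ⟨by rw [← h.univ_eq, Finset.pair_comm], h.ab, h.ba, h.dc, h.cd, h.ad, h.ac, h.bd, h.bc⟩

theorem swap_pairs (h : IsPairing P a b c d) : IsPairing P c d a b :=
  ⟨by rw [← h.univ_eq]; ext; simp; tauto, h.cd, h.dc, h.ab, h.ba,
    h.ac.symm, h.bc.symm, h.ad.symm, h.bd.symm⟩

end IsPairing

theorem ne_of_insert_eq_univ {a b c d : Team}
    (h : ({a, b, c, d} : Finset Team) = Finset.univ) :
    a ≠ b ∧ a ≠ c ∧ a ≠ d ∧ b ≠ c ∧ b ≠ d ∧ c ≠ d := by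
  revert a b c d; decide

theorem exists_isPairing {P : Finset (Team × Team)} (hP : AfterMD4 P) (i : Team) :
    ∃ b c d, IsPairing P i b c d := by
  obtain ⟨-, hor, a, b, c, d, huniv, hab, hba, hcd, hdc, honly⟩ := hP
  obtain ⟨nab, nac, nad, nbc, nbd, ncd⟩ := ne_of_insert_eq_univ huniv
  have cross : ∀ x y : Team, x ≠ y → ({x, y} : Finset Team) ≠ {a, b} →
      ({x, y} : Finset Team) ≠ {c, d} → Xor ((x, y) ∈ P) ((y, x) ∈ P) := by
    intro x y hxy h₁ h₂
    have h₃ := hor x y hxy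
    have h₄ := honly x y
    unfold Xor
    tauto
  have key : IsPairing P a b c d := by
    refine ⟨huniv, hab, hba, hcd, hdc, ?_, ?_, ?_, ?_⟩ <;> clear honly hor hab hba hcd hdc <;>
      apply cross <;> clear cross <;> revert a b c d <;> decide
  have hi : i ∈ ({a, b, c, d} : Finset Team) := huniv ▸ Finset.mem_univ i
  simp only [Finset.mem_insert, Finset.mem_singleton] at hi
  rcases hi with rfl | rfl | rfl | rfl
  · exact ⟨_, _, _, key⟩
  · exact ⟨_, _, _, key.swap_left⟩
  · exact ⟨_, _, _, key.swap_pairs⟩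
  · exact ⟨_, _, _, key.swap_pairs.swap_left⟩

theorem totalPts_eq_sum (T : Tournament) (i : Team) :
    totalPts T i = ∑ j ∈ Finset.univ.erase i, mutualPts T i j := by
  rw [← Finset.filter_ne']
  fin_cases i <;>
    simp [totalPts, currentPts, allMatches, mutualPts, Finset.sum_filter,
      Fintype.sum_prod_type, Fin.sum_univ_four] <;> ring

theorem goalDiff_eq_sum (T : Tournament) (i : Team) :
    goalDiff T i = ∑ j ∈ Finset.univ.erase i, mutualGD T i j := by
  rw [← Finset.filter_ne']
  fin_cases i <;>
    simp [goalDiff, allMatches, mutualGD, Finset.sum_filter,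
      Fintype.sum_prod_type, Fin.sum_univ_four] <;> ring

theorem totalPts_eq {a b c d : Team} (h : ({a, b, c, d} : Finset Team) = Finset.univ)
    (T : Tournament) :
    totalPts T a = mutualPts T a b + mutualPts T a c + mutualPts T a d := by
  obtain ⟨nab, nac, nad, nbc, nbd, ncd⟩ := ne_of_insert_eq_univ h
  rw [totalPts_eq_sum, ← h, Finset.erase_insert (by simp [*]), Finset.sum_insert (by simp [*]),
    Finset.sum_pair ncd, add_assoc]

theorem goalDiff_eq {a b c d : Team} (h : ({a, b, c, d} : Finset Team) = Finset.univ)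
    (T : Tournament) :
    goalDiff T a = mutualGD T a b + mutualGD T a c + mutualGD T a d := by
  obtain ⟨nab, nac, nad, nbc, nbd, ncd⟩ := ne_of_insert_eq_univ h
  rw [goalDiff_eq_sum, ← h, Finset.erase_insert (by simp [*]), Finset.sum_insert (by simp [*]),
    Finset.sum_pair ncd, add_assoc]

theorem mutualGD_swap (T : Tournament) (i j : Team) : mutualGD T j i = -mutualGD T i j := by
  unfold mutualGD; ring

theorem matchPts_mul {M : ℕ} (hM : 0 < M) (u v : ℕ) :
    matchPts (M * u) (M * v) = matchPts u v := by
  simp [matchPts, hM, hM.ne']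

theorem matchPts_add_le (g h : ℕ) : matchPts g h + matchPts h g ≤ 3 := by
  unfold matchPts; split_ifs <;> omega

/-- The completion in which the unplayed matches are decided by strength `r`, scaled by `M`. -/
def completeBy (P : Finset (Team × Team)) (T : Tournament) (M : ℕ) (r : Team → ℕ) : Tournament :=
  fun i j => if (i, j) ∈ P then T i j else (M * r i, M * r j)

theorem completes_completeBy (P : Finset (Team × Team)) (T : Tournament) (M : ℕ) (r : Team → ℕ) :
    Completes P T (completeBy P T M r) := by
  rintro ⟨i, j⟩ hm
  simp [completeBy, hm]

section completeBy

variable {P : Finset (Team × Team)} {T : Tournament}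

theorem mutual_completeBy_of_mem {x y : Team} (hxy : (x, y) ∈ P) (hyx : (y, x) ∈ P)
    (M : ℕ) (r : Team → ℕ) :
    mutualPts (completeBy P T M r) x y = mutualPts T x y ∧
      mutualGD (completeBy P T M r) x y = mutualGD T x y := by
  simp [mutualPts, mutualGD, completeBy, hxy, hyx]

theorem exists_mutual_completeBy {K M : ℕ} (hM : 0 < M)
    (hK : ∀ i j, (T i j).1 ≤ K ∧ (T i j).2 ≤ K) {x y : Team}
    (hxy : Xor ((x, y) ∈ P) ((y, x) ∈ P)) :
    ∃ g h : ℕ, g ≤ K ∧ h ≤ K ∧ ∀ r : Team → ℕ,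
      mutualPts (completeBy P T M r) x y = matchPts g h + matchPts (r x) (r y) ∧
      mutualPts (completeBy P T M r) y x = matchPts h g + matchPts (r y) (r x) ∧
      mutualGD (completeBy P T M r) x y = (g - h : ℤ) + M * (r x - r y) := by
  rcases hxy with ⟨h₁, h₂⟩ | ⟨h₁, h₂⟩
  · refine ⟨(T x y).1, (T x y).2, (hK x y).1, (hK x y).2, fun r => ?_⟩
    simp [mutualPts, mutualGD, completeBy, h₁, h₂, matchPts_mul hM]
    refine ⟨add_comm _ _, by ring⟩
  · refine ⟨(T y x).2, (T y x).1, (hK y x).2, (hK y x).1, fun r => ?_⟩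
    simp [mutualPts, mutualGD, completeBy, h₁, h₂, matchPts_mul hM]
    refine ⟨add_comm _ _, by ring⟩

end completeBy

/-- Strengths `α` for `a`, `β` for `b`, and `1` for the other teams. -/
def strength (a b : Team) (α β : ℕ) (x : Team) : ℕ := if x = a then α else if x = b then β else 1

theorem exists_goal_bound (T : Tournament) : ∃ K, ∀ i j, (T i j).1 ≤ K ∧ (T i j).2 ≤ K := by
  obtain ⟨K, hK⟩ := (Set.finite_range fun m : Team × Team =>
    max (T m.1 m.2).1 (T m.1 m.2).2).bddAbove
  exact ⟨K, fun i j => max_le_iff.1 (hK ⟨(i, j), rfl⟩)⟩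

/-- A ranking relation that refines the order by total points. -/
def RefinesPts (R : Tournament → Team → Team → Prop) : Prop :=
  ∀ T i j, (totalPts T j < totalPts T i → R T i j) ∧ (R T i j → totalPts T j ≤ totalPts T i)

theorem refinesPts_GD : RefinesPts RankedAboveGD := by
  intro T i j; unfold RankedAboveGD; omega

theorem refinesPts_H2H : RefinesPts RankedAboveH2H := by
  intro T i j; unfold RankedAboveH2H; omega

/-- A team losing to `a` by margin `M` stays below `a` on equal points, and a team
beating `a` by margin `M` stays above `a` on equal points. -/
def FavoursMargin (R : Tournament → Team → Team → Prop) (P : Finset (Team × Team))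
    (T : Tournament) (M : ℕ) : Prop :=
  ∀ a b c d, IsPairing P a b c d → ∀ β, β = 0 ∨ β = 2 →
    (R (completeBy P T M (strength a b 2 β)) c a →
      totalPts (completeBy P T M (strength a b 2 β)) a <
        totalPts (completeBy P T M (strength a b 2 β)) c) ∧
    (totalPts (completeBy P T M (strength a b 0 β)) a ≤
        totalPts (completeBy P T M (strength a b 0 β)) c →
      R (completeBy P T M (strength a b 0 β)) c a)

theorem favoursMargin_GD (P : Finset (Team × Team)) {T : Tournament} {K : ℕ}
    (hK : ∀ i j, (T i j).1 ≤ K ∧ (T i j).2 ≤ K) :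
    FavoursMargin RankedAboveGD P T (10 * K + 1) := by
  intro a b c d h β hβ
  obtain ⟨nab, nac, nad, nbc, nbd, ncd⟩ := ne_of_insert_eq_univ h.univ_eq
  obtain ⟨g₁, h₁, hg₁, hh₁, e₁⟩ := exists_mutual_completeBy (Nat.succ_pos (10 * K)) hK h.ac
  obtain ⟨g₂, h₂, hg₂, hh₂, e₂⟩ := exists_mutual_completeBy (Nat.succ_pos (10 * K)) hK h.ad
  obtain ⟨g₃, h₃, hg₃, hh₃, e₃⟩ := exists_mutual_completeBy (Nat.succ_pos (10 * K)) hK h.bc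
  have gap : ∀ r : Team → ℕ, ∃ e : ℤ, |e| ≤ 9 * K ∧
      goalDiff (completeBy P T (10 * K + 1) r) a - goalDiff (completeBy P T (10 * K + 1) r) c =
        e + (10 * K + 1 : ℕ) * ((r a - r c) + (r a - r d) + (r a - r c) + (r b - r c)) := by
    intro r
    refine ⟨mutualGD T a b + (g₁ - h₁) + (g₂ - h₂) + (g₁ - h₁) + (g₃ - h₃) - mutualGD T c d,
      ?_, ?_⟩
    · have := hK a b
      have := hK b a
      have := hK c d
      have := hK d c
      rw [abs_le]
      unfold mutualGD
      omega
    · rw [goalDiff_eq h.univ_eq, goalDiff_eq h.swap_pairs.univ_eq,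
        mutualGD_swap _ a c, mutualGD_swap _ b c,
        (e₁ r).2.2, (e₂ r).2.2, (e₃ r).2.2,
        (mutual_completeBy_of_mem h.ab h.ba _ r).2, (mutual_completeBy_of_mem h.cd h.dc _ r).2]
      ring
  obtain ⟨e, he, hgap⟩ := gap (strength a b 2 β)
  obtain ⟨e', he', hgap'⟩ := gap (strength a b 0 β)
  rw [abs_le] at he he'
  unfold RankedAboveGD
  rcases hβ with rfl | rfl <;>
    simp [strength, nab.symm, nac.symm, nad.symm, nbc.symm, nbd.symm] at hgap hgap' ⊢ <;> omega

theorem favoursMargin_H2H (P : Finset (Team × Team)) {T : Tournament} {K : ℕ}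
    (hK : ∀ i j, (T i j).1 ≤ K ∧ (T i j).2 ≤ K) :
    FavoursMargin RankedAboveH2H P T (10 * K + 1) := by
  intro a b c d h β hβ
  obtain ⟨nab, nac, nad, nbc, nbd, ncd⟩ := ne_of_insert_eq_univ h.univ_eq
  obtain ⟨g, h', hg, hh, e⟩ := exists_mutual_completeBy (Nat.succ_pos (10 * K)) hK h.ac
  have e₂ := e (strength a b 2 β)
  have e₀ := e (strength a b 0 β)
  have hp := matchPts_add_le g h'
  unfold RankedAboveH2H
  rw [mutualGD_swap _ a c, mutualGD_swap _ a c]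
  simp [strength, nac.symm, nbc.symm, show matchPts 2 1 = 3 from rfl,
    show matchPts 1 2 = 0 from rfl, show matchPts 0 1 = 0 from rfl,
    show matchPts 1 0 = 3 from rfl] at e₂ e₀ ⊢
  omega

open Classical in
theorem card_rankedAbove {R : Tournament → Team → Team → Prop} {T : Tournament} {a b c d : Team}
    (h : ({a, b, c, d} : Finset Team) = Finset.univ) (haa : ¬ R T a a) :
    (Finset.univ.filter fun j => R T j a).card =
      (if R T b a then 1 else 0) + (if R T c a then 1 else 0) + (if R T d a then 1 else 0) := by
  obtain ⟨nab, nac, nad, nbc, nbd, ncd⟩ := ne_of_insert_eq_univ h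
  rw [Finset.card_filter, ← h, Finset.sum_insert (by simp [*]), Finset.sum_insert (by simp [*]),
    Finset.sum_pair ncd, if_neg haa, zero_add, add_assoc]

theorem exists_totalPts_completeBy {P : Finset (Team × Team)} {T : Tournament} {a b c d : Team}
    {K M : ℕ} (hM : 0 < M) (hK : ∀ i j, (T i j).1 ≤ K ∧ (T i j).2 ≤ K)
    (h : IsPairing P a b c d) :
    ∃ pa pb pc pd : ℕ, pa ≤ 12 ∧ pb ≤ 12 ∧ pc ≤ 12 ∧ pd ≤ 12 ∧ pa + pb + pc + pd ≤ 24 ∧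
      ∀ α β, totalPts (completeBy P T M (strength a b α β)) a = pa + 2 * matchPts α 1 ∧
        totalPts (completeBy P T M (strength a b α β)) b = pb + 2 * matchPts β 1 ∧
        totalPts (completeBy P T M (strength a b α β)) c = pc + matchPts 1 α + matchPts 1 β ∧
        totalPts (completeBy P T M (strength a b α β)) d = pd + matchPts 1 α + matchPts 1 β := by
  obtain ⟨nab, nac, nad, nbc, nbd, ncd⟩ := ne_of_insert_eq_univ h.univ_eq
  obtain ⟨g₁, h₁, -, -, e₁⟩ := exists_mutual_completeBy hM hK h.ac
  obtain ⟨g₂, h₂, -, -, e₂⟩ := exists_mutual_completeBy hM hK h.ad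
  obtain ⟨g₃, h₃, -, -, e₃⟩ := exists_mutual_completeBy hM hK h.bc
  obtain ⟨g₄, h₄, -, -, e₄⟩ := exists_mutual_completeBy hM hK h.bd
  have i₁ := matchPts_add_le g₁ h₁
  have i₂ := matchPts_add_le g₂ h₂
  have i₃ := matchPts_add_le g₃ h₃
  have i₄ := matchPts_add_le g₄ h₄
  have j : ∀ x y, mutualPts T x y + mutualPts T y x ≤ 6 := by
    intro x y
    have := matchPts_add_le (T x y).1 (T x y).2
    have := matchPts_add_le (T y x).1 (T y x).2
    unfold mutualPts
    omega
  have j₁ := j a b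
  have j₂ := j c d
  refine ⟨mutualPts T a b + matchPts g₁ h₁ + matchPts g₂ h₂,
    mutualPts T b a + matchPts g₃ h₃ + matchPts g₄ h₄,
    mutualPts T c d + matchPts h₁ g₁ + matchPts h₃ g₃,
    mutualPts T d c + matchPts h₂ g₂ + matchPts h₄ g₄,
    by omega, by omega, by omega, by omega, by omega, fun α β => ?_⟩
  rw [totalPts_eq h.univ_eq, totalPts_eq h.swap_left.univ_eq, totalPts_eq h.swap_pairs.univ_eq,
    totalPts_eq h.swap_pairs.swap_left.univ_eq,
    (mutual_completeBy_of_mem h.ab h.ba _ _).1, (mutual_completeBy_of_mem h.ba h.ab _ _).1,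
    (mutual_completeBy_of_mem h.cd h.dc _ _).1, (mutual_completeBy_of_mem h.dc h.cd _ _).1,
    (e₁ _).1, (e₁ _).2.1, (e₂ _).1, (e₂ _).2.1, (e₃ _).1, (e₃ _).2.1, (e₄ _).1, (e₄ _).2.1]
  simp only [strength, nab.symm, nac.symm, nad.symm, nbc.symm, nbd.symm, if_true, if_false]
  omega

section count

variable {B C D : Prop} [Decidable B] [Decidable C] [Decidable D] {x y : ℕ}

theorem of_count_eq_one (h : (x < y → B) ∧ (B → x ≤ y))
    (n : (if B then 1 else 0) + (if C then 1 else 0) + (if D then 1 else 0) = 1) :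
    (x ≤ y ∧ ¬ C ∧ ¬ D) ∨ (y ≤ x ∧ C ∧ ¬ D) ∨ (y ≤ x ∧ ¬ C ∧ D) := by
  by_cases hB : B <;> by_cases hC : C <;> by_cases hD : D <;> simp_all

theorem of_count_eq_two (h : (x < y → B) ∧ (B → x ≤ y))
    (n : (if B then 1 else 0) + (if C then 1 else 0) + (if D then 1 else 0) = 2) :
    (x ≤ y ∧ C ∧ ¬ D) ∨ (x ≤ y ∧ ¬ C ∧ D) ∨ (y ≤ x ∧ C ∧ D) := by
  by_cases hB : B <;> by_cases hC : C <;> by_cases hD : D <;> simp_all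

end count

open Classical in
theorem exists_completion_card_ne {R : Tournament → Team → Team → Prop}
    {P : Finset (Team × Team)} {T : Tournament} {K M : ℕ} (hM : 0 < M)
    (hK : ∀ i j, (T i j).1 ≤ K ∧ (T i j).2 ≤ K) (hR : RefinesPts R)
    (hirr : ∀ T i, ¬ R T i i) (hfav : FavoursMargin R P T M) (hP : AfterMD4 P) (a : Team)
    {k : ℕ} (hk : k = 1 ∨ k = 2) :
    ∃ T', Completes P T T' ∧ (Finset.univ.filter fun j => R T' j a).card ≠ k := by
  obtain ⟨b, c, d, h⟩ := exists_isPairing hP a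
  obtain ⟨pa, pb, pc, pd, ha, hb, hc, hd, hsum, hpts⟩ := exists_totalPts_completeBy hM hK h
  by_contra! hall
  have hcount : ∀ α β, _ := fun α β =>
    (card_rankedAbove h.univ_eq (hirr _ a)).symm.trans
      (hall _ (completes_completeBy P T M (strength a b α β)))
  have win : ∀ β, β = 0 ∨ β = 2 → ∀ x, x = c ∨ x = d →
      (R (completeBy P T M (strength a b 2 β)) x a ↔
        totalPts (completeBy P T M (strength a b 2 β)) a <
          totalPts (completeBy P T M (strength a b 2 β)) x) := by
    rintro β hβ x (rfl | rfl)
    · exact ⟨(hfav _ _ _ _ h β hβ).1, (hR _ _ _).1⟩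
    · exact ⟨(hfav _ _ _ _ h.swap_right β hβ).1, (hR _ _ _).1⟩
  have lose : ∀ β, β = 0 ∨ β = 2 → ∀ x, x = c ∨ x = d →
      (R (completeBy P T M (strength a b 0 β)) x a ↔
        totalPts (completeBy P T M (strength a b 0 β)) a ≤
          totalPts (completeBy P T M (strength a b 0 β)) x) := by
    rintro β hβ x (rfl | rfl)
    · exact ⟨(hR _ _ _).2, (hfav _ _ _ _ h β hβ).2⟩
    · exact ⟨(hR _ _ _).2, (hfav _ _ _ _ h.swap_right β hβ).2⟩
  have rival := fun α β => hR (completeBy P T M (strength a b α β)) b a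
  have n₁ := hcount 2 0
  have n₂ := hcount 2 2
  have n₃ := hcount 0 2
  have n₄ := hcount 0 0
  rw [win 0 (.inl rfl) c (.inl rfl), win 0 (.inl rfl) d (.inr rfl)] at n₁
  rw [win 2 (.inr rfl) c (.inl rfl), win 2 (.inr rfl) d (.inr rfl)] at n₂
  rw [lose 2 (.inr rfl) c (.inl rfl), lose 2 (.inr rfl) d (.inr rfl)] at n₃
  rw [lose 0 (.inl rfl) c (.inl rfl), lose 0 (.inl rfl) d (.inr rfl)] at n₄
  have r₁ := rival 2 0
  have r₂ := rival 2 2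
  have r₃ := rival 0 2
  have r₄ := rival 0 0
  simp only [(hpts _ _).1, (hpts _ _).2.1, (hpts _ _).2.2.1, (hpts _ _).2.2.2,
    show matchPts 2 1 = 3 from rfl, show matchPts 1 2 = 0 from rfl,
    show matchPts 0 1 = 0 from rfl, show matchPts 1 0 = 3 from rfl] at n₁ n₂ n₃ n₄ r₁ r₂ r₃ r₄
  clear win lose rival hcount hall hpts hfav hirr hR
  rcases hk with rfl | rfl
  · have m₁ := of_count_eq_one r₁ n₁
    have m₂ := of_count_eq_one r₂ n₂
    have m₄ := of_count_eq_one r₄ n₄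
    omega
  · have m₁ := of_count_eq_two r₁ n₁
    have m₂ := of_count_eq_two r₂ n₂
    have m₃ := of_count_eq_two r₃ n₃
    have m₄ := of_count_eq_two r₄ n₄
    omega

/-- After Matchday 4, under either tiebreak rule, no team is
certain to finish second and no team is certain to finish third. -/
theorem secondAndThird_not_determined_after_MD4
    (P : Finset (Team × Team)) (T : Tournament) (hP : AfterMD4 P) :
    (¬ ∃ i : Team, ∀ T' : Tournament, Completes P T T' → finalPosGD T' i = 2) ∧
    (¬ ∃ i : Team, ∀ T' : Tournament, Completes P T T' → finalPosGD T' i = 3) ∧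
    (¬ ∃ i : Team, ∀ T' : Tournament, Completes P T T' → finalPosH2H T' i = 2) ∧
    (¬ ∃ i : Team, ∀ T' : Tournament, Completes P T T' → finalPosH2H T' i = 3) := by
  obtain ⟨K, hK⟩ := exists_goal_bound T
  have hM : 0 < 10 * K + 1 := Nat.succ_pos _
  have irrGD : ∀ T i, ¬ RankedAboveGD T i i := fun T i => by simp [RankedAboveGD]
  have irrH2H : ∀ T i, ¬ RankedAboveH2H T i i := fun T i => by simp [RankedAboveH2H]
  have hGD := fun i k => exists_completion_card_ne (k := k) hM hK refinesPts_GD irrGD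
    (favoursMargin_GD P hK) hP i
  have hH2H := fun i k => exists_completion_card_ne (k := k) hM hK refinesPts_H2H irrH2H
    (favoursMargin_H2H P hK) hP i
  refine ⟨?_, ?_, ?_, ?_⟩ <;> rintro ⟨i, hi⟩
  · obtain ⟨T', hT', hne⟩ := hGD i 1 (.inl rfl)
    exact hne (Nat.add_left_cancel (hi T' hT'))
  · obtain ⟨T', hT', hne⟩ := hGD i 2 (.inr rfl)
    exact hne (Nat.add_left_cancel (hi T' hT'))
  · obtain ⟨T', hT', hne⟩ := hH2H i 1 (.inl rfl)
    exact hne (Nat.add_left_cancel (hi T' hT'))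
  · obtain ⟨T', hT', hne⟩ := hH2H i 2 (.inr rfl)
    exact hne (Nat.add_left_cancel (hi T' hT'))
end

section
/- After Matchday 4, suppose team B's doubled opponent is team A (both ordered matches between A and B belong to P), B's current points equal exactly 3, and B obtained all of these points in its matches against A (B scored 0 points in its matches against the other two teams). Then at least one of the two teams other than A and B has at least 5 current points. -/
/-- Points obtained by team `i` against team `j` in the played matches of `P`. -/
def ptsVs (P : Finset (Team × Team)) (T : Tournament) (i j : Team) : ℕ :=
  ∑ m ∈ P,
    (if m = (i, j) then matchPts (T i j).1 (T i j).2
     else if m = (j, i) then matchPts (T j i).2 (T j i).1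
     else 0)

theorem ptsVs_eq (P : Finset (Team × Team)) (T : Tournament) {i j : Team} (hij : i ≠ j) :
    ptsVs P T i j =
      (if (i, j) ∈ P then matchPts (T i j).1 (T i j).2 else 0) +
        (if (j, i) ∈ P then matchPts (T j i).2 (T j i).1 else 0) := by
  have hne : (i, j) ≠ (j, i) := fun h => hij (congrArg Prod.fst h)
  rw [← Finset.sum_ite_eq' P (i, j) fun _ => matchPts (T i j).1 (T i j).2,
    ← Finset.sum_ite_eq' P (j, i) fun _ => matchPts (T j i).2 (T j i).1,
    ← Finset.sum_add_distrib, ptsVs]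
  refine Finset.sum_congr rfl fun m _ => ?_
  by_cases h : m = (i, j)
  · simp [h, hne]
  · simp [h]

theorem ptsVs_add_ptsVs_le_currentPts (P : Finset (Team × Team)) (T : Tournament)
    {i j k : Team} (hij : i ≠ j) (hik : i ≠ k) (hjk : j ≠ k) :
    ptsVs P T i j + ptsVs P T i k ≤ currentPts P T i := by
  rw [ptsVs, ptsVs, currentPts, ← Finset.sum_add_distrib]
  refine Finset.sum_le_sum fun m _ => ?_
  obtain ⟨x, y⟩ := m
  simp only [Prod.mk.injEq]
  grind

/-- At least two points are awarded in every match. -/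
theorem two_le_matchPts_add_matchPts (g c : ℕ) : 2 ≤ matchPts g c + matchPts c g := by
  unfold matchPts
  split_ifs <;> omega

theorem matchPts_eq_three_of_eq_zero {g c : ℕ} (h : matchPts g c = 0) : matchPts c g = 3 := by
  unfold matchPts at *
  split_ifs at * <;> omega

/-- A team that took no points from an opponent it has met conceded at least one win. -/
theorem three_le_ptsVs_of_ptsVs_eq_zero {P : Finset (Team × Team)} {T : Tournament} {i j : Team}
    (hij : i ≠ j) (hP : (i, j) ∈ P ∨ (j, i) ∈ P) (h : ptsVs P T i j = 0) :
    3 ≤ ptsVs P T j i := by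
  rw [ptsVs_eq P T hij, Nat.add_eq_zero_iff] at h
  rw [ptsVs_eq P T hij.symm]
  rcases hP with hp | hp
  · have := matchPts_eq_three_of_eq_zero ((if_pos hp).symm.trans h.1)
    simp only [if_pos hp]
    omega
  · have := matchPts_eq_three_of_eq_zero ((if_pos hp).symm.trans h.2)
    simp only [if_pos hp]
    omega

/-- Two teams that played both of their matches shared at least four points. -/
theorem four_le_ptsVs_add_ptsVs {P : Finset (Team × Team)} (T : Tournament) {i j : Team}
    (hij : i ≠ j) (h₁ : (i, j) ∈ P) (h₂ : (j, i) ∈ P) :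
    4 ≤ ptsVs P T i j + ptsVs P T j i := by
  rw [ptsVs_eq P T hij, ptsVs_eq P T hij.symm]
  simp only [if_pos h₁, if_pos h₂]
  have := two_le_matchPts_add_matchPts (T i j).1 (T i j).2
  have := two_le_matchPts_add_matchPts (T j i).1 (T j i).2
  omega

/-- If `A` and `B` are each other's doubled opponents, so are the other two teams. -/
theorem AfterMD4.mem_of_mem {P : Finset (Team × Team)} (hP : AfterMD4 P) {A B C D : Team}
    (h₁ : (A, B) ∈ P) (h₂ : (B, A) ∈ P) (hCA : C ≠ A) (hCB : C ≠ B) (hDA : D ≠ A) (hDB : D ≠ B)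
    (hCD : C ≠ D) : (C, D) ∈ P := by
  obtain ⟨-, -, a, b, c, d, huniv, hab, hba, hcd, hdc, h⟩ := hP
  have mem (x : Team) : x = a ∨ x = b ∨ x = c ∨ x = d := by
    simpa [← huniv] using Finset.mem_univ x
  have pair {x y : Team} (hxy : ({A, B} : Finset Team) = {x, y}) :
      (x = A ∨ x = B) ∧ (y = A ∨ y = B) := by
    constructor
    · simpa using (hxy ▸ by simp : x ∈ ({A, B} : Finset Team))
    · simpa using (hxy ▸ by simp : y ∈ ({A, B} : Finset Team))
  have hC := mem C
  have hD := mem D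
  rcases h A B h₁ h₂ with h | h <;> have := pair h <;> grind

/-- Among four teams, two distinct ones leave two distinct others. -/
theorem exists_other_teams (A B : Team) (hAB : A ≠ B) :
    ∃ C D : Team, C ≠ A ∧ C ≠ B ∧ D ≠ A ∧ D ≠ B ∧ C ≠ D := by
  revert A B
  decide

/-- After Matchday 4, if `B`'s doubled opponent is `A`, `B` has
exactly 3 current points, all obtained against `A`, then one of the two other
teams has at least 5 current points. -/
theorem threePoints_vs_doubled_opponent_gives_other_team_five
    (P : Finset (Team × Team)) (T : Tournament) (hP : AfterMD4 P)
    (A B : Team) (hAB : A ≠ B)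
    (h₁ : (A, B) ∈ P) (h₂ : (B, A) ∈ P)
    (hB : currentPts P T B = 3)
    (hzero : ∀ c : Team, c ≠ A → c ≠ B → ptsVs P T B c = 0) :
    ∃ c : Team, c ≠ A ∧ c ≠ B ∧ 5 ≤ currentPts P T c := by
  obtain ⟨C, D, hCA, hCB, hDA, hDB, hCD⟩ := exists_other_teams A B hAB
  have hC := three_le_ptsVs_of_ptsVs_eq_zero hCB.symm (hP.2.1 B C hCB.symm) (hzero C hCA hCB)
  have hD := three_le_ptsVs_of_ptsVs_eq_zero hDB.symm (hP.2.1 B D hDB.symm) (hzero D hDA hDB)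
  have hshared := four_le_ptsVs_add_ptsVs T hCD
    (hP.mem_of_mem h₁ h₂ hCA hCB hDA hDB hCD) (hP.mem_of_mem h₁ h₂ hDA hDB hCA hCB hCD.symm)
  have hC' := ptsVs_add_ptsVs_le_currentPts P T hCB hCD hDB.symm
  have hD' := ptsVs_add_ptsVs_le_currentPts P T hDB hCD.symm hCB.symm
  by_cases h : 5 ≤ currentPts P T C
  · exact ⟨C, hCA, hCB, h⟩
  · exact ⟨D, hDA, hDB, by omega⟩
end

section
/- Let π be a real number with 1/2 < π < 1, let Δ((h₁,a₁),(h₂,a₂)) = √((h₁−h₂)² − 2π(h₁−h₂)(a₁−a₂) + (a₁−a₂)²), and define χ((h₁,a₁),(h₂,a₂)) to be 0 if the two pairs have the same outcome (both satisfy h > a, or both h = a, or both h < a), 2 if one satisfies h > a and the other h < a, and 1 otherwise. Then Θ = Δ + χ is a metric on ℝ × ℝ: for all x, y, z, one has Θ(x,y) ≥ 0 with Θ(x,y) = 0 if and only if x = y, Θ(x,y) = Θ(y,x), and Θ(x,z) ≤ Θ(x,y) + Θ(y,z). -/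
/-- The 'distance of match scores' with parameter `π`:
`Δ π (h₁,a₁) (h₂,a₂) = √((h₁−h₂)² − 2π(h₁−h₂)(a₁−a₂) + (a₁−a₂)²)`. -/
noncomputable def Δ (π : ℝ) (x y : ℝ × ℝ) : ℝ :=
  Real.sqrt ((x.1 - y.1) ^ 2 - 2 * π * (x.1 - y.1) * (x.2 - y.2) + (x.2 - y.2) ^ 2)

open Classical in
/-- The outcome penalty `χ`: `0` if the two score pairs have the same outcome
(home win / draw / away win), `2` if one is a home win and the other an away
win, and `1` otherwise. -/
noncomputable def chi (x y : ℝ × ℝ) : ℝ :=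
  if (x.2 < x.1 ∧ y.2 < y.1) ∨ (x.1 = x.2 ∧ y.1 = y.2) ∨ (x.1 < x.2 ∧ y.1 < y.2) then 0
  else if (x.2 < x.1 ∧ y.1 < y.2) ∨ (x.1 < x.2 ∧ y.2 < y.1) then 2
  else 1

/-- The 'distance of match scores and outcomes' `Θ = Δ + χ`. -/
noncomputable def Θ (π : ℝ) (x y : ℝ × ℝ) : ℝ := Δ π x y + chi x y

/-- `chi` is the pseudometric pulled back from the sign of the goal difference. -/
theorem chi_eq_abs_sign_sub_sign (x y : ℝ × ℝ) :
    chi x y = |Real.sign (x.1 - x.2) - Real.sign (y.1 - y.2)| := by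
  unfold chi Real.sign
  simp only [sub_neg, sub_pos]
  rcases lt_trichotomy x.1 x.2 with h | h | h <;>
  rcases lt_trichotomy y.1 y.2 with h' | h' | h' <;>
  simp [h, h', not_lt_of_ge, le_of_lt, ne_of_lt, ne_of_gt] <;> norm_num

theorem chi_nonneg (x y : ℝ × ℝ) : 0 ≤ chi x y := by
  rw [chi_eq_abs_sign_sub_sign]
  exact abs_nonneg _

theorem chi_self (x : ℝ × ℝ) : chi x x = 0 := by
  simp [chi_eq_abs_sign_sub_sign]

theorem chi_comm (x y : ℝ × ℝ) : chi x y = chi y x := by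
  simp only [chi_eq_abs_sign_sub_sign]
  exact abs_sub_comm _ _

theorem chi_triangle (x y z : ℝ × ℝ) : chi x z ≤ chi x y + chi y z := by
  simp only [chi_eq_abs_sign_sub_sign]
  exact abs_sub_le _ _ _

theorem Δ_nonneg (π : ℝ) (x y : ℝ × ℝ) : 0 ≤ Δ π x y :=
  Real.sqrt_nonneg _

theorem Δ_self (π : ℝ) (x : ℝ × ℝ) : Δ π x x = 0 := by
  simp [Δ]

theorem Δ_comm (π : ℝ) (x y : ℝ × ℝ) : Δ π x y = Δ π y x := by
  unfold Δ
  congr 1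
  ring

theorem quadForm_nonneg {π : ℝ} (hπ : π ^ 2 ≤ 1) (p s : ℝ) :
    0 ≤ p ^ 2 - 2 * π * p * s + s ^ 2 := by
  linear_combination sq_nonneg (p - π * s) + mul_nonneg (sub_nonneg.2 hπ) (sq_nonneg s)

theorem eq_of_Δ_eq_zero {π : ℝ} (hπ : π ^ 2 < 1) {x y : ℝ × ℝ} (h : Δ π x y = 0) : x = y := by
  have h0 := (Real.sqrt_eq_zero (quadForm_nonneg hπ.le _ _)).1 h
  have h2 : x.2 - y.2 = 0 := by
    have : (1 - π ^ 2) * (x.2 - y.2) ^ 2 = 0 := by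
      refine le_antisymm ?_ (mul_nonneg (sub_nonneg.2 hπ.le) (sq_nonneg _))
      linear_combination h0 + sq_nonneg (x.1 - y.1 - π * (x.2 - y.2))
    exact pow_eq_zero_iff two_ne_zero |>.1
      ((mul_eq_zero.1 this).resolve_left (sub_pos.2 hπ).ne')
  have h1 : x.1 - y.1 = 0 := by
    simpa [h2] using h0
  exact Prod.ext (sub_eq_zero.1 h1) (sub_eq_zero.1 h2)

theorem Δ_triangle {π : ℝ} (hπ : π ^ 2 ≤ 1) (x y z : ℝ × ℝ) :
    Δ π x z ≤ Δ π x y + Δ π y z := by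
  have hxy : Δ π x y ^ 2 = _ := Real.sq_sqrt (quadForm_nonneg hπ _ _)
  have hyz : Δ π y z ^ 2 = _ := Real.sq_sqrt (quadForm_nonneg hπ _ _)
  have cauchy_schwarz : (x.1 - y.1) * (y.1 - z.1) + (x.2 - y.2) * (y.2 - z.2)
      - π * ((x.1 - y.1) * (y.2 - z.2) + (x.2 - y.2) * (y.1 - z.1)) ≤ Δ π x y * Δ π y z := by
    refine abs_le_of_sq_le_sq' ?_ (mul_nonneg (Δ_nonneg π x y) (Δ_nonneg π y z)) |>.2
    rw [mul_pow, hxy, hyz]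
    linear_combination mul_nonneg (sub_nonneg.2 hπ)
      (sq_nonneg ((x.1 - y.1) * (y.2 - z.2) - (x.2 - y.2) * (y.1 - z.1)))
  refine Real.sqrt_le_iff.2 ⟨add_nonneg (Δ_nonneg π x y) (Δ_nonneg π y z), ?_⟩
  rw [add_sq, hxy, hyz]
  linear_combination 2 * cauchy_schwarz

/-- For `1/2 < π < 1`, the distance of match scores and
outcomes `Θ π = Δ π + χ` is a metric on `ℝ × ℝ`. -/
theorem distanceOfMatchScoresAndOutcomes_isMetric (π : ℝ) (hl : 1 / 2 < π) (hu : π < 1) :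
    (∀ x y : ℝ × ℝ, 0 ≤ Θ π x y) ∧
    (∀ x y : ℝ × ℝ, Θ π x y = 0 ↔ x = y) ∧
    (∀ x y : ℝ × ℝ, Θ π x y = Θ π y x) ∧
    (∀ x y z : ℝ × ℝ, Θ π x z ≤ Θ π x y + Θ π y z) := by
  have hπ : π ^ 2 < 1 := by nlinarith
  refine ⟨fun x y => add_nonneg (Δ_nonneg π x y) (chi_nonneg x y), fun x y => ⟨fun h => ?_, ?_⟩,
    fun x y => congrArg₂ (· + ·) (Δ_comm π x y) (chi_comm x y), fun x y z => ?_⟩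
  · exact eq_of_Δ_eq_zero hπ
      ((add_eq_zero_iff_of_nonneg (Δ_nonneg π x y) (chi_nonneg x y)).1 h).1
  · rintro rfl
    simp [Θ, Δ_self, chi_self]
  · unfold Θ
    linarith [Δ_triangle hπ.le x y z, chi_triangle x y z]
end
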